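/- Let G be a connected graph on n ≥ 4 vertices with minimum degree δ(G) ≥ 2. If ρ_D(G) ≤ (2n² + 6n − 28)/n, then G is traceable from every vertex. -/

import Mathlib

open SimpleGraph Finset

/-- The transmission of a vertex: sum of distances to all other vertices. -/
noncomputable def transmission {V : Type*} [Fintype V] (G : SimpleGraph V) (u : V) : ℕ :=
  ∑ v, G.dist u v

/-- The transmission σ(G): sum of distances over all unordered pairs. -/
noncomputable def transmissionOf {V : Type*} [Fintype V] (G : SimpleGraph V) : ℝ :=
  (1 / 2) * ∑ u, ∑ v, (G.dist u v : ℝ)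

/-- The distance signless Laplacian matrix Q_D(G) = Tr(G) + 𝒟(G). -/
noncomputable def distSignlessLaplacian {V : Type*} [Fintype V] [DecidableEq V]
    (G : SimpleGraph V) : Matrix V V ℝ :=
  fun u v => (if u = v then (transmission G u : ℝ) else 0) + (G.dist u v : ℝ)

/-- `ρ` is the distance signless Laplacian spectral radius of `G`,
i.e. the largest eigenvalue of `Q_D(G)`. -/
noncomputable def IsDistSLSpectralRadius {V : Type*} [Fintype V] [DecidableEq V]
    (G : SimpleGraph V) (ρ : ℝ) : Prop :=
  IsGreatest {μ : ℝ | Module.End.HasEigenvalue (Matrix.toLin' (distSignlessLaplacian G)) μ} ρ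

/-- Join of two graphs. -/
def joinGraph {α β : Type*} (G : SimpleGraph α) (H : SimpleGraph β) : SimpleGraph (α ⊕ β) :=
  SimpleGraph.fromRel (fun x y =>
    match x, y with
    | Sum.inl a, Sum.inl b => G.Adj a b
    | Sum.inr a, Sum.inr b => H.Adj a b
    | Sum.inl _, Sum.inr _ => True
    | Sum.inr _, Sum.inl _ => False)

/-- The graph H_{t,n-t}. -/
def HGraph (n t : ℕ) : SimpleGraph (Fin n ⊕ Fin n) :=
  SimpleGraph.fromRel (fun x y =>
    match x, y with
    | Sum.inl i, Sum.inr j => (j : ℕ) < n - t ∨ (i : ℕ) < t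
    | _, _ => False)

/-- Hamilton-connected. -/
def IsHamiltonianConnected {V : Type*} [DecidableEq V] (G : SimpleGraph V) : Prop :=
  ∀ u v : V, u ≠ v → ∃ p : G.Walk u v, p.IsHamiltonian

/-- Traceable from every vertex. -/
def TraceableFromEveryVertex {V : Type*} [DecidableEq V] (G : SimpleGraph V) : Prop :=
  ∀ u : V, ∃ v : V, ∃ p : G.Walk u v, p.IsHamiltonian

/-- K_{n-1} + e : complete graph on n-1 vertices with a pendant edge. -/
def KPlusPendant (n : ℕ) : SimpleGraph (Fin (n - 1) ⊕ Fin 1) :=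
  SimpleGraph.fromRel (fun x y =>
    match x, y with
    | Sum.inl a, Sum.inl b => a ≠ b
    | Sum.inl a, Sum.inr _ => (a : ℕ) = 0
    | _, _ => False)

/-- `G` has a Hamilton path starting at `x`, given as an enumeration of the vertices by
`0, …, card V - 1`. -/
def HasHamiltonPathFrom {V : Type*} [Fintype V] (G : SimpleGraph V) (x : V) : Prop :=
  ∃ f : ℕ → V, f 0 = x ∧ (∀ v, ∃ i < Fintype.card V, f i = v) ∧
    (∀ i < Fintype.card V, ∀ j < Fintype.card V, f i = f j → i = j) ∧
    ∀ i, i + 1 < Fintype.card V → G.Adj (f i) (f (i + 1))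

theorem exists_walk_support_eq_map_range {V : Type*} {G : SimpleGraph V} (f : ℕ → V) (m : ℕ)
    (h : ∀ i < m, G.Adj (f i) (f (i + 1))) :
    ∃ p : G.Walk (f 0) (f m), p.support = (List.range (m + 1)).map f := by
  induction m with
  | zero => exact ⟨Walk.nil, by simp⟩
  | succ m ih =>
    obtain ⟨p, hp⟩ := ih fun i hi => h i (by omega)
    refine ⟨p.concat (h m (by omega)), ?_⟩
    rw [Walk.support_concat, hp, List.range_succ (n := m + 1)]
    simp

section HamiltonPath

variable {V : Type*} [Fintype V] {G : SimpleGraph V} {x : V}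

theorem HasHamiltonPathFrom.exists_isHamiltonian [DecidableEq V] (h : HasHamiltonPathFrom G x) :
    ∃ v, ∃ p : G.Walk x v, p.IsHamiltonian := by
  obtain ⟨f, rfl, hs, hi, ha⟩ := h
  have hpos : 0 < Fintype.card V := Fintype.card_pos_iff.2 ⟨f 0⟩
  obtain ⟨p, hp⟩ := exists_walk_support_eq_map_range (G := G) f (Fintype.card V - 1)
    fun i hi => ha i (by omega)
  rw [Nat.sub_add_cancel hpos] at hp
  refine ⟨_, p, fun v => List.count_eq_one_of_mem ?_ ?_⟩
  · rw [hp]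
    exact List.Nodup.map_on (fun i hi' j hj' => hi i (by simpa using hi') j (by simpa using hj'))
      List.nodup_range
  · obtain ⟨i, hi', rfl⟩ := hs v
    rw [hp]
    exact List.mem_map.2 ⟨i, by simpa using hi', rfl⟩

theorem hasHamiltonPathFrom_top (x : V) : HasHamiltonPathFrom (⊤ : SimpleGraph V) x := by
  classical
  have hpos : 0 < Fintype.card V := Fintype.card_pos_iff.2 ⟨x⟩
  let e := (Fintype.equivFin V).trans (Equiv.swap (Fintype.equivFin V x) ⟨0, hpos⟩)
  have he : e.symm ⟨0, hpos⟩ = x := by simp [e]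
  have hinj : ∀ i (hi : i < Fintype.card V) j (hj : j < Fintype.card V),
      e.symm ⟨i, hi⟩ = e.symm ⟨j, hj⟩ → i = j := fun i hi j hj h => by simpa using h
  refine ⟨fun i => if h : i < Fintype.card V then e.symm ⟨i, h⟩ else x, by simp [hpos, he],
    fun v => ⟨e v, (e v).2, by simp⟩, fun i hi j hj h => ?_, fun i hi => ?_⟩
  · simp only [hi, hj, dif_pos] at h
    exact hinj i hi j hj h
  · have hi' : i < Fintype.card V := by omega
    simp only [hi, hi', dif_pos, top_adj]
    intro h
    have := hinj _ _ _ _ h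
    omega

/-- Reversing the segment `[a, b]` of an enumeration of the vertices. -/
theorem HasHamiltonPathFrom.of_reverse_segment {f : ℕ → V} {a b : ℕ} (h0 : f 0 = x)
    (hs : ∀ v, ∃ i < Fintype.card V, f i = v)
    (hi : ∀ i < Fintype.card V, ∀ j < Fintype.card V, f i = f j → i = j)
    (ha : 1 ≤ a) (hab : a ≤ b) (hb : b < Fintype.card V)
    (hleft : G.Adj (f (a - 1)) (f b))
    (hright : b + 1 < Fintype.card V → G.Adj (f a) (f (b + 1)))
    (hrest : ∀ i, i + 1 < Fintype.card V → i + 1 ≠ a → i ≠ b → G.Adj (f i) (f (i + 1))) :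
    HasHamiltonPathFrom G x := by
  refine ⟨fun i => f (if a ≤ i ∧ i ≤ b then a + b - i else i), ?_, fun v => ?_,
    fun i hi' j hj' h => ?_, fun i hi' => ?_⟩
  · simpa [show ¬ a ≤ 0 by omega] using h0
  · obtain ⟨i, hi', rfl⟩ := hs v
    refine ⟨if a ≤ i ∧ i ≤ b then a + b - i else i, by split_ifs <;> omega, congrArg f ?_⟩
    split_ifs <;> omega
  · have := hi _ (by split_ifs <;> omega) _ (by split_ifs <;> omega) h
    split_ifs at this <;> omega
  · rcases lt_trichotomy (i + 1) a with h | h | h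
    · simp only [show ¬ (a ≤ i ∧ i ≤ b) by omega, show ¬ (a ≤ i + 1 ∧ i + 1 ≤ b) by omega,
        if_false]
      exact hrest i hi' (by omega) (by omega)
    · simp only [show ¬ (a ≤ i ∧ i ≤ b) by omega, show a ≤ i + 1 ∧ i + 1 ≤ b by omega,
        if_false, if_true, and_self]
      rwa [show a + b - (i + 1) = b by omega, show i = a - 1 by omega]
    · rcases lt_trichotomy i b with h' | h' | h'
      · simp only [show a ≤ i ∧ i ≤ b by omega, show a ≤ i + 1 ∧ i + 1 ≤ b by omega,
          if_true, and_self]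
        have := (hrest (a + b - (i + 1)) (by omega) (by omega) (by omega)).symm
        rwa [show a + b - (i + 1) + 1 = a + b - i by omega] at this
      · simp only [show a ≤ i ∧ i ≤ b by omega, show ¬ (a ≤ i + 1 ∧ i + 1 ≤ b) by omega,
          if_true, if_false, and_self]
        rw [show a + b - i = a by omega, h']
        exact hright (by omega)
      · simp only [show ¬ (a ≤ i ∧ i ≤ b) by omega, show ¬ (a ≤ i + 1 ∧ i + 1 ≤ b) by omega,
          if_false]
        exact hrest i hi' (by omega) (by omega)

theorem degree_add_degree_lt_of_broken_path [DecidableRel G.Adj]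
    (hG : ¬ HasHamiltonPathFrom G x) {f : ℕ → V} {i : ℕ} (h0 : f 0 = x)
    (hs : ∀ v, ∃ i < Fintype.card V, f i = v)
    (hi : ∀ i < Fintype.card V, ∀ j < Fintype.card V, f i = f j → i = j)
    (hin : i + 1 < Fintype.card V)
    (hrest : ∀ j, j + 1 < Fintype.card V → j ≠ i → G.Adj (f j) (f (j + 1))) :
    G.degree (f i) + G.degree (f (i + 1)) + 1 ≤ Fintype.card V := by
  classical
  have key : ∀ j < Fintype.card V, G.Adj (f i) (f j) →
      j + 1 < Fintype.card V ∧ ¬ G.Adj (f (i + 1)) (f (j + 1)) := by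
    intro j hj hadj
    by_contra hcon
    have hnext : j + 1 < Fintype.card V → G.Adj (f (i + 1)) (f (j + 1)) := by tauto
    rcases lt_trichotomy j i with h | rfl | h
    · exact hG <| .of_reverse_segment (a := j + 1) (b := i) h0 hs hi (by omega) (by omega)
        (by omega) hadj.symm (fun _ => (hnext (by omega)).symm) fun k hk _ hki => hrest k hk hki
    · exact G.irrefl hadj
    · exact hG <| .of_reverse_segment (a := i + 1) (b := j) h0 hs hi (by omega) (by omega)
        hj hadj hnext fun k hk hki _ => hrest k hk (by omega)
  have hcard : G.degree (f i) = #{j ∈ range (Fintype.card V) | G.Adj (f i) (f j)} := by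
    rw [← card_neighborFinset_eq_degree]
    refine (card_bij (fun j _ => f j) (by simp) ?_ ?_).symm
    · intro a ha b hb
      simp only [mem_filter, mem_range] at ha hb
      exact hi a ha.1 b hb.1
    · intro w hw
      obtain ⟨j, hj, rfl⟩ := hs w
      exact ⟨j, by simpa [hj] using hw, rfl⟩
  have hle : #{j ∈ range (Fintype.card V) | G.Adj (f i) (f j)} ≤
      #(insert (f (i + 1)) (G.neighborFinset (f (i + 1))))ᶜ := by
    refine card_le_card_of_injOn (fun j => f (j + 1)) ?_ ?_
    · intro j hj
      simp only [coe_filter, mem_range, Set.mem_ofPred_eq] at hj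
      obtain ⟨h1, h2⟩ := key j hj.1 hj.2
      simp only [coe_compl, Set.mem_compl_iff, mem_coe, mem_insert, mem_neighborFinset, not_or]
      refine ⟨fun h => ?_, h2⟩
      have := hi _ h1 _ hin h
      obtain rfl : j = i := by omega
      exact G.irrefl hj.2
    · intro j hj k hk h
      simp only [coe_filter, mem_range, Set.mem_ofPred_eq] at hj hk
      have := hi _ (key j hj.1 hj.2).1 _ (key k hk.1 hk.2).1 h
      omega
  rw [card_compl, card_insert_of_notMem (by simp), card_neighborFinset_eq_degree] at hle
  have := G.degree_lt_card_verts (f (i + 1))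
  omega

/-- Bondy–Chvátal closure step for Hamilton paths with a prescribed starting vertex. -/
theorem degree_add_degree_lt_of_sup_edge [DecidableRel G.Adj] {u v : V}
    (hG : ¬ HasHamiltonPathFrom G x) (h : HasHamiltonPathFrom (G ⊔ edge u v) x) :
    G.degree u + G.degree v + 1 ≤ Fintype.card V := by
  obtain ⟨f, h0, hs, hi, ha⟩ := h
  have hbroken : ∃ i, i + 1 < Fintype.card V ∧ ¬ G.Adj (f i) (f (i + 1)) := by
    by_contra! hcon
    exact hG ⟨f, h0, hs, hi, hcon⟩
  obtain ⟨i, hin, hni⟩ := hbroken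
  have hedge : ∀ j, j + 1 < Fintype.card V → ¬ G.Adj (f j) (f (j + 1)) →
      (f j = u ∧ f (j + 1) = v) ∨ (f j = v ∧ f (j + 1) = u) := by
    intro j hj hnj
    have := ha j hj
    rw [sup_adj, edge_adj] at this
    tauto
  have hlt := degree_add_degree_lt_of_broken_path hG h0 hs hi hin fun j hj hji => by
    by_contra hnj
    have h1 := hi j (by omega) i (by omega)
    have h2 := hi j (by omega) (i + 1) hin
    have h3 := hi (j + 1) hj i (by omega)
    rcases hedge j hj hnj with ⟨a, b⟩ | ⟨a, b⟩ <;> rcases hedge i hin hni with ⟨c, d⟩ | ⟨c, d⟩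
    · exact hji (h1 (a.trans c.symm))
    · have := h2 (a.trans d.symm)
      have := h3 (b.trans c.symm)
      omega
    · have := h2 (a.trans d.symm)
      have := h3 (b.trans c.symm)
      omega
    · exact hji (h1 (a.trans c.symm))
  rcases hedge i hin hni with ⟨c, d⟩ | ⟨c, d⟩ <;> rw [c, d] at hlt <;> omega

/-- A Chvátal-type degree condition for Hamilton paths with a prescribed starting vertex. -/
theorem exists_degree_bounds_of_not_hasHamiltonPathFrom [DecidableRel G.Adj]
    (hG : ¬ HasHamiltonPathFrom G x) :
    ∃ (k : ℕ) (S R : Finset V), 2 * k + 1 ≤ Fintype.card V ∧ S ⊆ R ∧ #S = k ∧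
      #R = Fintype.card V - k ∧ (∀ w ∈ S, G.degree w ≤ k) ∧
      (∀ w ∈ R, G.degree w + k + 1 ≤ Fintype.card V) ∧ ∃ w, G.degree w ≤ k := by
  classical
  obtain ⟨H, hGH, hH⟩ := Finite.exists_le_maximal
    (p := fun H : SimpleGraph V => ¬ HasHamiltonPathFrom H x) hG
  have hdeg : ∀ w, G.degree w ≤ H.degree w := fun w => degree_le_of_le hGH
  have hore : ∀ u v, u ≠ v → ¬ H.Adj u v → H.degree u + H.degree v + 1 ≤ Fintype.card V := by
    intro u v huv hnadj
    refine degree_add_degree_lt_of_sup_edge hH.prop ?_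
    by_contra hcon
    have : edge u v ≤ H := le_sup_right.trans (hH.le_of_ge hcon le_sup_left)
    exact hnadj (this ((edge_adj ..).2 ⟨.inl ⟨rfl, rfl⟩, huv⟩))
  have hne : ({p : V × V | p.1 ≠ p.2 ∧ ¬ H.Adj p.1 p.2} : Finset (V × V)).Nonempty := by
    by_contra hcon
    refine hH.prop ?_
    have : H = ⊤ := by
      ext u v
      simp only [not_nonempty_iff_eq_empty, filter_eq_empty_iff, mem_univ, true_imp_iff,
        not_and, not_not, Prod.forall] at hcon
      exact ⟨fun h => h.ne, fun h => hcon u v h⟩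
    rw [this]
    exact hasHamiltonPathFrom_top x
  obtain ⟨u, v, huv, hnadj, hmax, hle⟩ : ∃ u v, u ≠ v ∧ ¬ H.Adj u v ∧
      (∀ a b, a ≠ b → ¬ H.Adj a b → H.degree a + H.degree b ≤ H.degree u + H.degree v) ∧
      H.degree u ≤ H.degree v := by
    obtain ⟨⟨u, v⟩, hmem, hmax⟩ := exists_max_image _
      (fun p : V × V => H.degree p.1 + H.degree p.2) hne
    simp only [mem_filter, mem_univ, true_and, and_imp, Prod.forall] at hmem hmax
    rcases le_total (H.degree u) (H.degree v) with h | h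
    · exact ⟨u, v, hmem.1, hmem.2, hmax, h⟩
    · exact ⟨v, u, hmem.1.symm, fun h => hmem.2 h.symm,
        fun a b hab hn => (hmax a b hab hn).trans_eq (add_comm _ _), h⟩
  have huv_lt := hore u v huv hnadj
  obtain ⟨S, hS, hScard⟩ : ∃ S ⊆ (insert v (H.neighborFinset v))ᶜ, #S = H.degree u := by
    refine exists_subset_card_eq ?_
    rw [card_compl, card_insert_of_notMem (by simp), card_neighborFinset_eq_degree]
    omega
  have hSdeg : ∀ w ∈ S, H.degree w ≤ H.degree u := by
    intro w hw
    have := hS hw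
    simp only [mem_compl, mem_insert, mem_neighborFinset, not_or] at this
    have := hmax w v this.1 fun h => this.2 h.symm
    omega
  obtain ⟨R, hSR, hR, hRcard⟩ : ∃ R, S ⊆ R ∧ R ⊆ S ∪ (H.neighborFinset u)ᶜ ∧
      #R = Fintype.card V - H.degree u := by
    refine exists_subsuperset_card_eq subset_union_left (by omega) ?_
    refine le_trans ?_ (card_le_card subset_union_right)
    rw [card_compl, card_neighborFinset_eq_degree]
  refine ⟨H.degree u, S, R, by omega, hSR, hScard, hRcard,
    fun w hw => (hdeg w).trans (hSdeg w hw), fun w hw => ?_, u, hdeg u⟩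
  have := hdeg w
  rcases mem_union.1 (hR hw) with h | h
  · have := hSdeg w h
    omega
  · by_cases hwu : w = u
    · subst hwu
      omega
    · have := hmax w u hwu (by simpa [H.adj_comm] using h)
      omega

end HamiltonPath

section DegreeSum

variable {V : Type*} [Fintype V] [DecidableEq V] {G : SimpleGraph V} [DecidableRel G.Adj]

theorem sum_degree_le_of_degree_bounds {k : ℕ} {S R : Finset V}
    (hk : 2 * k + 1 ≤ Fintype.card V) (hSR : S ⊆ R) (hS : #S = k) (hR : #R = Fintype.card V - k)
    (hdS : ∀ w ∈ S, G.degree w ≤ k) (hdR : ∀ w ∈ R, G.degree w + k + 1 ≤ Fintype.card V) :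
    (∑ w, G.degree w : ℤ) ≤ Fintype.card V * (Fintype.card V - 1) -
      k * (Fintype.card V - k) - (Fintype.card V - 1 - 2 * k) * k := by
  have hpoint : ∀ w, (G.degree w : ℤ) ≤ (Fintype.card V - 1 : ℤ) -
      (if w ∈ R then (k : ℤ) else 0) -
      (if w ∈ S then (Fintype.card V - 1 - 2 * k : ℤ) else 0) := by
    intro w
    have h1 := G.degree_lt_card_verts w
    have h2 := hdS w
    have h3 := hdR w
    have h4 := @hSR w
    split_ifs with hwR hwS hwS
    · have := h2 hwS
      omega
    · have := h3 hwR
      omega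
    · exact absurd (h4 hwS) hwR
    · omega
  refine (sum_le_sum fun w _ => hpoint w).trans_eq ?_
  rw [sum_sub_distrib, sum_sub_distrib]
  simp only [sum_const, card_univ, sum_ite_mem, univ_inter, hS, hR, nsmul_eq_mul]
  rw [Nat.cast_sub (by omega)]
  ring

theorem eq_or_small_of_le_sum_degree_bound {n k : ℕ} (hk : 2 ≤ k) (hkn : 2 * k + 1 ≤ n) {D : ℤ}
    (hlow : (n : ℤ) ^ 2 - 5 * n + 14 ≤ D)
    (hup : D ≤ n * (n - 1) - k * (n - k) - (n - 1 - 2 * k) * k) :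
    D = (n : ℤ) ^ 2 - 5 * n + 14 ∨ ((k = 3 ∧ n = 7) ∨ (k = 4 ∧ n = 9)) ∧
      D ≤ (n : ℤ) ^ 2 - 5 * n + 16 := by
  have hprod : D ≤ (n : ℤ) ^ 2 - 5 * n + 14 + (k - 2) * (3 * k + 7 - 2 * n) := by
    refine hup.trans_eq ?_
    ring
  have hk5 : k = 2 ∨ k ≤ 5 := by
    by_contra! hcon
    obtain ⟨_, h5⟩ := hcon
    have h1 : (0 : ℤ) < k - 2 := by omega
    have h2 : (3 * k + 7 - 2 * n : ℤ) < 0 := by omega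
    have := mul_neg_of_pos_of_neg h1 h2
    omega
  have hcases : k = 2 ∨ k = 3 ∨ k = 4 ∨ k = 5 := by omega
  rcases hcases with rfl | rfl | rfl | rfl
  · left
    push_cast at hprod
    linarith
  · push_cast at hprod
    omega
  · push_cast at hprod
    omega
  · push_cast at hprod
    omega

/-- The extremal graphs of `sum_degree_le_of_degree_bounds` for `card V = 2 * k + 1`. -/
theorem not_adj_of_sum_degree_extremal {k : ℕ} {R : Finset V} (hn : Fintype.card V = 2 * k + 1)
    (hR : #R = k + 1) (hdR : ∀ w ∈ R, G.degree w ≤ k)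
    (hsum : 3 * k ^ 2 + k ≤ ∑ w, G.degree w) {a b : V} (ha : a ∈ R) (hb : b ∈ R) :
    ¬ G.Adj a b := by
  have hle : ∀ w ∈ univ, G.degree w ≤ if w ∈ R then k else 2 * k := by
    intro w _
    split_ifs with h
    · exact hdR w h
    · have := G.degree_lt_card_verts w
      omega
  have htot : ∑ w, (if w ∈ R then k else 2 * k) = 3 * k ^ 2 + k := by
    rw [← sum_add_sum_compl R, sum_congr rfl fun w hw => if_pos hw,
      sum_congr rfl fun w hw => if_neg (mem_compl.1 hw), sum_const, sum_const, card_compl, hR, hn,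
      show 2 * k + 1 - (k + 1) = k by omega]
    simp only [smul_eq_mul]
    ring
  have heq := (sum_eq_sum_iff_of_le hle).1 (le_antisymm (sum_le_sum hle) (htot.trans_le hsum))
  have hfull : ∀ w ∉ R, G.Adj a w := by
    intro w hw
    have hdeg : G.degree w = 2 * k := by simpa [hw] using heq w (mem_univ _)
    have hsub : G.neighborFinset w ⊆ univ.erase w := by
      intro z hz
      simpa using ((G.mem_neighborFinset w z).1 hz).ne'
    have := eq_of_subset_of_card_le hsub (by
      rw [card_erase_of_mem (mem_univ _), card_univ, card_neighborFinset_eq_degree]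
      omega)
    have haw : a ∈ G.neighborFinset w := by
      rw [this]
      simpa using fun h : a = w => hw (h ▸ ha)
    exact ((G.mem_neighborFinset w a).1 haw).symm
  intro hab
  have hsub : insert b Rᶜ ⊆ G.neighborFinset a := by
    intro w hw
    rw [mem_neighborFinset]
    rcases mem_insert.1 hw with rfl | hw
    · exact hab
    · exact hfull w (mem_compl.1 hw)
  have := card_le_card hsub
  rw [card_insert_of_notMem (by simpa using hb), card_compl, card_neighborFinset_eq_degree] at this
  have := hdR a ha
  omega

end DegreeSum

theorem two_le_dist_add_ite_adj {V : Type*} [DecidableEq V] {G : SimpleGraph V}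
    [DecidableRel G.Adj] (hG : G.Connected) (u v : V) :
    2 ≤ G.dist u v + (if G.Adj u v then 1 else 0) + (if u = v then 2 else 0) := by
  rcases eq_or_ne u v with rfl | huv
  · simp
  · have hpos := hG.pos_dist_of_ne huv
    by_cases hadj : G.Adj u v
    · simp only [hadj, if_true]
      omega
    · have : G.dist u v ≠ 1 := fun h => hadj (dist_eq_one_iff_adj.1 h)
      omega

theorem two_mul_card_le_transmission_add_degree {V : Type*} [Fintype V]
    {G : SimpleGraph V} [DecidableRel G.Adj] (hG : G.Connected) (u : V) :
    2 * Fintype.card V ≤ transmission G u + G.degree u + 2 := by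
  classical
  have h := sum_le_sum fun v (_ : v ∈ univ) => two_le_dist_add_ite_adj hG u v
  rw [sum_add_distrib, sum_add_distrib, ← card_filter] at h
  rw [← card_neighborFinset_eq_degree, neighborFinset_eq_filter, transmission]
  simpa [mul_comm] using h

theorem sum_dist_mul_one_add_one {V : Type*} [Fintype V] {G : SimpleGraph V} :
    ∑ u : V, ∑ v : V, (G.dist u v : ℝ) * ((1 : ℝ) ^ 2 + 1 * 1) =
      2 * (∑ u, transmission G u : ℝ) := by
  simp only [transmission, ← sum_mul, Nat.cast_sum]
  ring

section Spectral

open Matrix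

variable {V : Type*} [Fintype V] [DecidableEq V] {G : SimpleGraph V} {ρ : ℝ}

theorem posSemidef_smul_one_sub_of_isGreatest {A : Matrix V V ℝ} (hA : A.IsHermitian)
    (hρ : IsGreatest {μ : ℝ | Module.End.HasEigenvalue (Matrix.toLin' A) μ} ρ) :
    (ρ • (1 : Matrix V V ℝ) - A).PosSemidef := by
  have hM : (ρ • (1 : Matrix V V ℝ) - A).IsHermitian :=
    (isHermitian_one.smul (IsSelfAdjoint.all ρ)).sub hA
  rw [hM.posSemidef_iff_eigenvalues_nonneg]
  intro i
  have hv := hM.mulVec_eigenvectorBasis i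
  set v : V → ℝ := ⇑(hM.eigenvectorBasis i)
  have hv0 : v ≠ 0 := by
    intro h
    exact hM.eigenvectorBasis.orthonormal.ne_zero i (PiLp.ext fun j => congrFun h j)
  have heig : Module.End.HasEigenvalue (Matrix.toLin' A) (ρ - hM.eigenvalues i) := by
    refine Module.End.hasEigenvalue_of_hasEigenvector (x := v)
      (Module.End.hasEigenvector_iff.2 ⟨Module.End.mem_eigenspace_iff.2 ?_, hv0⟩)
    rw [toLin'_apply, sub_smul, ← hv, sub_mulVec, smul_mulVec, one_mulVec]
    abel
  have := hρ.2 heig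
  simp only [Pi.zero_apply]
  linarith

theorem isHermitian_distSignlessLaplacian : (distSignlessLaplacian G).IsHermitian := by
  ext u v
  simp only [conjTranspose_apply, distSignlessLaplacian, star_trivial, G.dist_comm (u := v),
    eq_comm (a := v)]
  split_ifs with h
  · rw [h]
  · rfl

theorem distSignlessLaplacian_mulVec (x : V → ℝ) (u : V) :
    (distSignlessLaplacian G *ᵥ x) u = ∑ v, G.dist u v * (x u + x v) := by
  simp only [mulVec, dotProduct, distSignlessLaplacian, add_mul, sum_add_distrib, ite_mul, zero_mul,
    sum_ite_eq, mem_univ, if_true, transmission, mul_add, Nat.cast_sum, sum_mul]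

theorem IsDistSLSpectralRadius.posSemidef (hρ : IsDistSLSpectralRadius G ρ) :
    (ρ • (1 : Matrix V V ℝ) - distSignlessLaplacian G).PosSemidef :=
  posSemidef_smul_one_sub_of_isGreatest isHermitian_distSignlessLaplacian hρ

theorem dotProduct_smul_one_sub_distSignlessLaplacian (x : V → ℝ) :
    star x ⬝ᵥ ((ρ • (1 : Matrix V V ℝ) - distSignlessLaplacian G) *ᵥ x) =
      ρ * ∑ u, x u ^ 2 - ∑ u, ∑ v, G.dist u v * (x u ^ 2 + x u * x v) := by
  rw [sub_mulVec, smul_mulVec, one_mulVec, star_trivial, dotProduct_sub, dotProduct_smul]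
  congr 1
  · simp [dotProduct, sq]
  · simp only [dotProduct, distSignlessLaplacian_mulVec, mul_sum]
    exact sum_congr rfl fun u _ => sum_congr rfl fun v _ => by ring

theorem IsDistSLSpectralRadius.sum_dist_mul_le (hρ : IsDistSLSpectralRadius G ρ) (x : V → ℝ) :
    ∑ u, ∑ v, G.dist u v * (x u ^ 2 + x u * x v) ≤ ρ * ∑ u, x u ^ 2 := by
  have := hρ.posSemidef.dotProduct_mulVec_nonneg x
  rw [dotProduct_smul_one_sub_distSignlessLaplacian] at this
  linarith

theorem IsDistSLSpectralRadius.two_mul_sum_transmission_le (hρ : IsDistSLSpectralRadius G ρ) :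
    2 * (∑ u, transmission G u : ℝ) ≤ ρ * Fintype.card V := by
  have := hρ.sum_dist_mul_le fun _ => 1
  rw [sum_dist_mul_one_add_one] at this
  simpa using this

theorem IsDistSLSpectralRadius.two_mul_transmission_eq (hρ : IsDistSLSpectralRadius G ρ)
    (h : ρ * Fintype.card V ≤ 2 * (∑ u, transmission G u : ℝ)) (u : V) :
    2 * (transmission G u : ℝ) = ρ := by
  have hzero : star (fun _ : V => (1 : ℝ)) ⬝ᵥ
      ((ρ • (1 : Matrix V V ℝ) - distSignlessLaplacian G) *ᵥ fun _ => 1) = 0 := by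
    rw [dotProduct_smul_one_sub_distSignlessLaplacian, sum_dist_mul_one_add_one]
    have := hρ.two_mul_sum_transmission_le
    simp only [one_pow, sum_const, card_univ, nsmul_eq_mul, mul_one]
    linarith
  have := congrFun ((hρ.posSemidef.dotProduct_mulVec_zero_iff _).1 hzero) u
  rw [sub_mulVec, smul_mulVec, one_mulVec, Pi.sub_apply, distSignlessLaplacian_mulVec,
    ← sum_mul] at this
  simp only [Pi.smul_apply, smul_eq_mul, Pi.zero_apply] at this
  rw [transmission]
  push_cast
  linarith

/-- Rayleigh quotient at the vector equal to `2` on an independent set and to `1` elsewhere. -/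
theorem IsDistSLSpectralRadius.le_mul_of_independent [DecidableRel G.Adj]
    (hρ : IsDistSLSpectralRadius G ρ) (hG : G.Connected) {k : ℕ} {R : Finset V}
    (hn : Fintype.card V = 2 * k + 1) (hR : #R = k + 1)
    (hind : ∀ a ∈ R, ∀ b ∈ R, ¬ G.Adj a b) :
    27 * (k : ℝ) ^ 2 + 23 * k ≤ ρ * (5 * k + 4) := by
  have hRc : #Rᶜ = k := by
    rw [card_compl]
    omega
  set x : V → ℝ := fun u => if u ∈ R then 2 else 1
  have hx1 : ∀ u ∈ R, x u = 2 := fun u hu => if_pos hu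
  have hx2 : ∀ u ∈ Rᶜ, x u = 1 := fun u hu => if_neg (mem_compl.1 hu)
  have hnorm : ∑ u, x u ^ 2 = 5 * k + 4 := by
    rw [← sum_add_sum_compl R, sum_congr rfl fun u hu => congrArg (· ^ 2) (hx1 u hu),
      sum_congr rfl fun u hu => congrArg (· ^ 2) (hx2 u hu), sum_const, sum_const, hR, hRc]
    simp only [nsmul_eq_mul]
    push_cast
    ring
  have hpos : ∀ u v, u ≠ v → (1 : ℝ) ≤ G.dist u v := fun u v h => by
    exact_mod_cast hG.pos_dist_of_ne h
  have hin : ∀ u ∈ R, 22 * (k : ℝ) ≤ ∑ v, G.dist u v * (x u ^ 2 + x u * x v) := by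
    intro u hu
    have h1 : ∀ v ∈ R, (if v = u then 0 else 16 : ℝ) ≤ G.dist u v * (x u ^ 2 + x u * x v) := by
      intro v hv
      rw [hx1 u hu, hx1 v hv]
      split_ifs with h
      · positivity
      · have h2 := two_le_dist_add_ite_adj hG u v
        simp only [hind u hu v hv, Ne.symm h, if_false, add_zero] at h2
        have : (2 : ℝ) ≤ G.dist u v := by exact_mod_cast h2
        linarith
    have h2 : ∀ v ∈ Rᶜ, (6 : ℝ) ≤ G.dist u v * (x u ^ 2 + x u * x v) := by
      intro v hv
      rw [hx1 u hu, hx2 v hv]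
      have := hpos u v fun h => (mem_compl.1 hv) (h ▸ hu)
      linarith
    rw [← sum_add_sum_compl R]
    refine le_trans (le_of_eq ?_) (add_le_add (sum_le_sum h1) (sum_le_sum h2))
    rw [← add_sum_erase R _ hu, sum_congr rfl fun v hv => if_neg (ne_of_mem_erase hv), sum_const,
      sum_const, card_erase_of_mem hu, hR, hRc]
    simp only [nsmul_eq_mul, if_true, Nat.add_sub_cancel]
    ring
  have hout : ∀ u ∈ Rᶜ, 5 * (k : ℝ) + 1 ≤ ∑ v, G.dist u v * (x u ^ 2 + x u * x v) := by
    intro u hu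
    have h1 : ∀ v ∈ R, (3 : ℝ) ≤ G.dist u v * (x u ^ 2 + x u * x v) := by
      intro v hv
      rw [hx2 u hu, hx1 v hv]
      have := hpos u v fun h => (mem_compl.1 hu) (h ▸ hv)
      linarith
    have h2 : ∀ v ∈ Rᶜ, (if v = u then 0 else 2 : ℝ) ≤ G.dist u v * (x u ^ 2 + x u * x v) := by
      intro v hv
      rw [hx2 u hu, hx2 v hv]
      split_ifs with h
      · positivity
      · have := hpos u v (Ne.symm h)
        linarith
    rw [← sum_add_sum_compl R]
    refine le_trans (le_of_eq ?_) (add_le_add (sum_le_sum h1) (sum_le_sum h2))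
    have hkpos : 1 ≤ k := hRc ▸ card_pos.2 ⟨u, hu⟩
    rw [← add_sum_erase Rᶜ _ hu, sum_congr rfl fun v hv => if_neg (ne_of_mem_erase hv), sum_const,
      sum_const, card_erase_of_mem hu, hR, hRc]
    simp only [nsmul_eq_mul, if_true]
    push_cast [hkpos]
    ring
  have h := hρ.sum_dist_mul_le x
  rw [hnorm, ← sum_add_sum_compl R] at h
  refine le_trans (le_trans (le_of_eq ?_) (add_le_add (sum_le_sum hin) (sum_le_sum hout))) h
  rw [sum_const, sum_const, hR, hRc]
  simp only [nsmul_eq_mul]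
  push_cast
  ring

end Spectral

/-- Theorem 8: spectral condition for traceability from every vertex. -/
theorem stmt_13 {V : Type*} [Fintype V] [DecidableEq V] (G : SimpleGraph V) [DecidableRel G.Adj]
    (hconn : G.Connected) (hn : 4 ≤ Fintype.card V)
    (hδ : ∀ v : V, 2 ≤ G.degree v)
    (ρ : ℝ) (hρ : IsDistSLSpectralRadius G ρ)
    (hle : ρ ≤ (2 * (Fintype.card V : ℝ) ^ 2 + 6 * (Fintype.card V : ℝ) - 28) /
      (Fintype.card V : ℝ)) :
    TraceableFromEveryVertex G := by
  intro x
  refine HasHamiltonPathFrom.exists_isHamiltonian ?_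
  by_contra hG
  obtain ⟨k, S, R, hkn, hSR, hS, hR, hdS, hdR, w₀, hw₀⟩ :=
    exists_degree_bounds_of_not_hasHamiltonPathFrom hG
  have hk : 2 ≤ k := (hδ w₀).trans hw₀
  have hup := sum_degree_le_of_degree_bounds hkn hSR hS hR hdS hdR
  have hρn : ρ * Fintype.card V ≤ 2 * (Fintype.card V : ℝ) ^ 2 + 6 * Fintype.card V - 28 :=
    (le_div_iff₀ (by exact_mod_cast (by omega : 0 < Fintype.card V))).1 hle
  have hW := hρ.two_mul_sum_transmission_le
  set n := Fintype.card V with hn_def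
  have hpoint := two_mul_card_le_transmission_add_degree hconn
  rw [← hn_def] at hpoint
  have hTD : 2 * (n : ℤ) * (n - 1) ≤ ∑ u, (transmission G u : ℤ) + ∑ u, (G.degree u : ℤ) := by
    rw [← sum_add_distrib]
    refine le_trans (le_of_eq ?_) (sum_le_sum (f := fun _ => 2 * (n : ℤ) - 2) fun u _ => ?_)
    · rw [sum_const, card_univ, nsmul_eq_mul, ← hn_def]
      ring
    · have := hpoint u
      omega
  have hWZ : ∑ u, (transmission G u : ℤ) ≤ (n : ℤ) ^ 2 + 3 * n - 14 := by
    have : (∑ u, transmission G u : ℝ) ≤ (n : ℝ) ^ 2 + 3 * n - 14 := by linarith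
    exact_mod_cast this
  have hlow : (n : ℤ) ^ 2 - 5 * n + 14 ≤ ∑ u, (G.degree u : ℤ) := by linarith
  have hregular : ∑ u, (G.degree u : ℤ) ≠ (n : ℤ) ^ 2 - 5 * n + 14 := by
    intro hD
    have hTsum : ∑ u, (transmission G u : ℤ) = (n : ℤ) ^ 2 + 3 * n - 14 := by linarith
    have hTsumR : (∑ u, transmission G u : ℝ) = (n : ℝ) ^ 2 + 3 * n - 14 := by
      exact_mod_cast hTsum
    have htrans := hρ.two_mul_transmission_eq (by rw [← hn_def]; linarith)
    have htight : ∀ u, (transmission G u : ℤ) + G.degree u = 2 * n - 2 := by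
      have hle : ∀ u ∈ univ, (2 * n - 2 : ℤ) ≤ transmission G u + G.degree u := by
        intro u _
        have := hpoint u
        omega
      have hsum : ∑ _u : V, (2 * n - 2 : ℤ) = ∑ u, ((transmission G u : ℤ) + G.degree u) := by
        rw [sum_add_distrib, hD, hTsum, sum_const, card_univ, nsmul_eq_mul, ← hn_def]
        ring
      exact fun u => ((sum_eq_sum_iff_of_le hle).1 hsum u (mem_univ u)).symm
    have hdeg : ∀ u, (G.degree u : ℤ) ≤ k := by
      intro u
      have h1 : (transmission G u : ℝ) = transmission G w₀ := by
        linarith [htrans u, htrans w₀]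
      have h2 : transmission G u = transmission G w₀ := by exact_mod_cast h1
      have h3 := htight u
      have h4 := htight w₀
      omega
    have hsum : ∑ u, (G.degree u : ℤ) ≤ n * k := by
      refine (sum_le_sum fun u _ => hdeg u).trans_eq ?_
      rw [sum_const, card_univ, nsmul_eq_mul]
    have hkn' : 2 * (k : ℤ) + 1 ≤ n := by exact_mod_cast hkn
    nlinarith [sq_nonneg (2 * (n : ℤ) - 9)]
  obtain h | ⟨hsmall, hDup⟩ := eq_or_small_of_le_sum_degree_bound hk hkn hlow hup
  · exact hregular h
  have heven := G.sum_degrees_eq_twice_card_edges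
  have hcast : ∑ u, (G.degree u : ℤ) = ((∑ u, G.degree u : ℕ) : ℤ) := by push_cast; rfl
  rw [hcast] at hlow hDup hregular
  have hodd : n = 2 * k + 1 := by omega
  have hRcard : #R = k + 1 := by omega
  have hind : ∀ a ∈ R, ∀ b ∈ R, ¬ G.Adj a b := fun a ha b hb =>
    not_adj_of_sum_degree_extremal hodd hRcard
      (fun w hw => by
        have := hdR w hw
        omega)
      (by rcases hsmall with ⟨rfl, h⟩ | ⟨rfl, h⟩ <;> rw [h] at hlow hregular <;> omega) ha hb
  have hbound := hρ.le_mul_of_independent hconn hodd hRcard hind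
  rcases hsmall with ⟨rfl, h⟩ | ⟨rfl, h⟩
  · rw [h] at hρn
    norm_num at hρn hbound
    linarith
  · rw [h] at hρn
    norm_num at hρn hbound
    linarith
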